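/- arXiv:2601.17840 — 7 statements merged into one kernel-verified Lean document; each statement's English description precedes it below -/
import Mathlib

section
/- Let R = (R_{ij}) be a complex 3×3 matrix and let H_R be the constant R-deformation of the Poisson bivector H of the subregular classical finite W-algebra of sl3. Then H_R satisfies the Jacobi identity (i.e., defines a Poisson bracket on ℂ[u1,u2,u3]) if and only if the following five relations among the entries of R hold: R11·R21 + R21·R22 + R23·R31 = 0, R12·R31 + R22·R32 + R32·R33 = 0, R11² + R12·R21 − R23·R32 − R33² = 0, R13·R21 + R22·R23 + R23·R33 = 0, and R11·R12 + R12·R22 + R13·R32 = 0. -/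
open MvPolynomial

/-- The Poisson bivector of the subregular classical finite W-algebra of `sl₃`:
`H¹² = −2u₁`, `H¹³ = u₂²`, `H²³ = −2u₃`, extended skew-symmetrically. -/
noncomputable def Hmat : Matrix (Fin 3) (Fin 3) (MvPolynomial (Fin 3) ℂ) :=
  !![0, -(2 * X 0), (X 1) ^ 2;
     2 * X 0, 0, -(2 * X 2);
     -((X 1) ^ 2), 2 * X 2, 0]

/-- A `3×3` matrix of polynomials satisfies the Jacobi identity if for all `i j k`,
`Σ_l ( P^{il}·∂P^{jk}/∂u_l + P^{jl}·∂P^{ki}/∂u_l + P^{kl}·∂P^{ij}/∂u_l ) = 0`. -/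
def JacobiId (P : Matrix (Fin 3) (Fin 3) (MvPolynomial (Fin 3) ℂ)) : Prop :=
  ∀ i j k : Fin 3,
    ∑ l : Fin 3,
      (P i l * pderiv l (P j k) + P j l * pderiv l (P k i) + P k l * pderiv l (P i j)) = 0

/-- The constant `R`-deformation of a bivector `P`:
`P_R^{ij} = Σ_k ( R_{ik}·P^{kj} + R_{jk}·P^{ik} )`. -/
noncomputable def Rdef (R : Matrix (Fin 3) (Fin 3) ℂ)
    (P : Matrix (Fin 3) (Fin 3) (MvPolynomial (Fin 3) ℂ)) :
    Matrix (Fin 3) (Fin 3) (MvPolynomial (Fin 3) ℂ) :=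
  Matrix.of fun i j => ∑ k : Fin 3, (C (R i k) * P k j + C (R j k) * P i k)

/-- The Jacobi expression of a bivector at a triple of indices. -/
noncomputable def jacobiator (P : Matrix (Fin 3) (Fin 3) (MvPolynomial (Fin 3) ℂ))
    (i j k : Fin 3) : MvPolynomial (Fin 3) ℂ :=
  ∑ l : Fin 3,
    (P i l * pderiv l (P j k) + P j l * pderiv l (P k i) + P k l * pderiv l (P i j))

/-- In three variables the Jacobi identity of a skew-symmetric matrix is a single equation. -/
theorem jacobiId_iff_of_skew {P : Matrix (Fin 3) (Fin 3) (MvPolynomial (Fin 3) ℂ)}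
    (hdiag : ∀ i, P i i = 0) (hskew : ∀ i j, P j i = -P i j) :
    JacobiId P ↔ jacobiator P 0 1 2 = 0 := by
  refine ⟨fun h => h 0 1 2, fun h i j k => ?_⟩
  simp only [jacobiator, Fin.sum_univ_three, hdiag, hskew 0 1, hskew 0 2, hskew 1 2,
    map_neg] at h
  fin_cases i <;> fin_cases j <;> fin_cases k <;>
    simp only [Fin.zero_eta, Fin.mk_one, Fin.reduceFinMk, Fin.sum_univ_three, hdiag,
      hskew 0 1, hskew 0 2, hskew 1 2, map_neg, map_zero] <;>
    first
    | ring1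
    | linear_combination h
    | linear_combination -h

theorem Rdef_Hmat_diag (R : Matrix (Fin 3) (Fin 3) ℂ) (i : Fin 3) : Rdef R Hmat i i = 0 := by
  fin_cases i <;> simp [Rdef, Hmat, Fin.sum_univ_three]

theorem Rdef_Hmat_skew (R : Matrix (Fin 3) (Fin 3) ℂ) (i j : Fin 3) :
    Rdef R Hmat j i = -Rdef R Hmat i j := by
  fin_cases i <;> fin_cases j <;> simp [Rdef, Hmat, Fin.sum_univ_three] <;> ring

theorem jacobiator_Rdef_Hmat (R : Matrix (Fin 3) (Fin 3) ℂ) :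
    jacobiator (Rdef R Hmat) 0 1 2 =
      -4 * C (R 0 0 * R 1 0 + R 1 0 * R 1 1 + R 1 2 * R 2 0) * (X 0 * X 1)
      + 4 * C (R 0 1 * R 2 0 + R 1 1 * R 2 1 + R 2 1 * R 2 2) * X 0
      + 2 * C (R 0 0 ^ 2 + R 0 1 * R 1 0 - R 1 2 * R 2 1 - R 2 2 ^ 2) * X 1 ^ 2
      + 4 * C (R 0 2 * R 1 0 + R 1 1 * R 1 2 + R 1 2 * R 2 2) * (X 1 * X 2)
      - 4 * C (R 0 0 * R 0 1 + R 0 1 * R 1 1 + R 0 2 * R 2 1) * X 2 := by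
  have hnum : ∀ l : Fin 3, pderiv l (2 : MvPolynomial (Fin 3) ℂ) = 0 := fun l =>
    pderiv_C (a := (2 : ℂ))
  simp [jacobiator, Rdef, Hmat, Fin.sum_univ_three, Derivation.leibniz, Derivation.leibniz_pow,
    pderiv_X, Pi.single_apply, hnum]
  ring

/-- The constant `R`-deformation `H_R` of the Poisson bivector `H` of the subregular
classical finite W-algebra of `sl₃` satisfies the Jacobi identity if and only if the five
polynomial relations `f₁ = ⋯ = f₅ = 0` among the entries of `R` hold. -/
theorem stmt0 (R : Matrix (Fin 3) (Fin 3) ℂ) :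
    JacobiId (Rdef R Hmat) ↔
      (R 0 0 * R 1 0 + R 1 0 * R 1 1 + R 1 2 * R 2 0 = 0 ∧
       R 0 1 * R 2 0 + R 1 1 * R 2 1 + R 2 1 * R 2 2 = 0 ∧
       R 0 0 ^ 2 + R 0 1 * R 1 0 - R 1 2 * R 2 1 - R 2 2 ^ 2 = 0 ∧
       R 0 2 * R 1 0 + R 1 1 * R 1 2 + R 1 2 * R 2 2 = 0 ∧
       R 0 0 * R 0 1 + R 0 1 * R 1 1 + R 0 2 * R 2 1 = 0) := by
  rw [jacobiId_iff_of_skew (Rdef_Hmat_diag R) (Rdef_Hmat_skew R), jacobiator_Rdef_Hmat]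
  constructor
  · intro h
    have key (x y z : ℂ) := congrArg (eval ![x, y, z]) h
    simp only [map_add, map_sub, map_mul, map_neg, map_pow, map_ofNat, map_zero, eval_C, eval_X,
      Matrix.cons_val] at key
    refine ⟨?_, ?_, ?_, ?_, ?_⟩
    · linear_combination (key 1 0 0 + key 0 1 0 - key 1 1 0) / 4
    · linear_combination key 1 0 0 / 4
    · linear_combination key 0 1 0 / 2
    · linear_combination (key 0 1 1 - key 0 1 0 - key 0 0 1) / 4
    · linear_combination -key 0 0 1 / 4
  · rintro ⟨h₁, h₂, h₃, h₄, h₅⟩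
    simp only [h₁, h₂, h₃, h₄, h₅, map_zero, mul_zero, zero_mul, add_zero, sub_zero]
end

section
/- (Type I, Cartan type.) Let R = diag(a, b, c) be a diagonal complex 3×3 matrix. Then the constant R-deformation H_R of the Poisson bivector H of the subregular classical finite W-algebra of sl3 satisfies the Jacobi identity if and only if c² = a², i.e., if and only if R = diag(a, b, ±a) for some a, b ∈ ℂ. -/
open MvPolynomial

/-- The `diag(a, b, c)`-deformation scales the `(i, j)` entry of `Hmat` by `rᵢ + rⱼ`. -/
theorem Rdef_diagonal_Hmat (a b c : ℂ) :
    Rdef (Matrix.diagonal ![a, b, c]) Hmat =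
      !![0, -(C (2 * (a + b)) * X 0), C (a + c) * X 1 ^ 2;
         C (2 * (a + b)) * X 0, 0, -(C (2 * (b + c)) * X 2);
         -(C (a + c) * X 1 ^ 2), C (2 * (b + c)) * X 2, 0] := by
  have h2 : (C 2 : MvPolynomial (Fin 3) ℂ) = 2 := map_ofNat C 2
  ext1 i j
  fin_cases i <;> fin_cases j <;>
    simp [Rdef, Hmat, Fin.sum_univ_three, Matrix.diagonal, h2] <;> ring

/-- (Type I, Cartan type.) For a diagonal matrix `R = diag(a, b, c)`, the constant
`R`-deformation `H_R` satisfies the Jacobi identity if and only if `c² = a²`,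
i.e. iff `R = diag(a, b, ±a)`. -/
theorem stmt1 (a b c : ℂ) :
    JacobiId (Rdef (Matrix.diagonal ![a, b, c]) Hmat) ↔ c ^ 2 = a ^ 2 := by
  rw [Rdef_diagonal_Hmat]
  constructor
  · intro h
    have h012 := congrArg (eval fun _ => (1 : ℂ)) (h 0 1 2)
    simp [Fin.sum_univ_three, pderiv_X, Pi.single_apply] at h012
    linear_combination (-1 / 2) * h012
  · intro h
    have hC : (C c ^ 2 : MvPolynomial (Fin 3) ℂ) = C a ^ 2 := by
      rw [← C_pow, ← C_pow, h]
    intro i j k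
    fin_cases i <;> fin_cases j <;> fin_cases k <;>
      simp [Fin.sum_univ_three, pderiv_X, Pi.single_apply] <;>
      first
      | ring1
      | linear_combination (C 2 * X 1 ^ 2) * hC
      | linear_combination (-C 2 * X 1 ^ 2) * hC
end

section
/- (Compatible Poisson pencil from Type III₊.) Let R = (R_{ij}) be a complex 3×3 matrix with R12 = R21 = R23 = R32 = 0 and R11 = R33 (a Type III₊ R-matrix). Then for every ε ∈ ℂ, the skew-symmetric matrix of polynomials H + ε·H_R satisfies the Jacobi identity; i.e., H and H_R form a compatible Poisson pencil on ℂ[u1,u2,u3]. -/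
open MvPolynomial

/-- (Compatible Poisson pencil from Type III₊.) For a Type III₊ matrix `R`
(`R₁₂ = R₂₁ = R₂₃ = R₃₂ = 0` and `R₁₁ = R₃₃`), for every `ε ∈ ℂ` the skew-symmetric
matrix of polynomials `H + ε·H_R` satisfies the Jacobi identity; i.e., `H` and `H_R`
form a compatible Poisson pencil on `ℂ[u₁,u₂,u₃]`. -/
theorem stmt4 (R : Matrix (Fin 3) (Fin 3) ℂ)
    (h12 : R 0 1 = 0) (h21 : R 1 0 = 0) (h23 : R 1 2 = 0) (h32 : R 2 1 = 0)
    (hplus : R 0 0 = R 2 2) :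
    ∀ ε : ℂ, JacobiId (Matrix.of fun i j => Hmat i j + C ε * Rdef R Hmat i j) := by
  have hC : ∀ l : Fin 3, pderiv l (2 : MvPolynomial (Fin 3) ℂ) = 0 := fun l => (pderiv l).map_natCast 2
  intro ε i j k
  fin_cases i <;> fin_cases j <;> fin_cases k <;>
    simp [Fin.sum_univ_three, Rdef, Hmat, h12, h21, h23, h32, hplus,
      pderiv_X, Pi.single_apply, hC] <;> ring
end

section
/- (Conservation of S along the R-deformed flow.) Let Δ, R13, R31 ∈ ℂ, let I ⊆ ℝ be an interval, and let u1, u2, u3 : I → ℂ be differentiable functions satisfying the system u1' = u2²·(Δ·u1 + R13·u3), u2' = 2·(R31·u1² − R13·u3²), u3' = −u2²·(R31·u1 + Δ·u3). Then the function S(t) := u2(t)³/6 + u1(t)·u3(t) is constant on I (its derivative vanishes identically). -/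
/-- (Conservation of `S` along the `R`-deformed flow.) If `u₁, u₂, u₃ : I → ℂ` are
differentiable on an interval `I ⊆ ℝ` and satisfy the system
`u₁' = u₂²(Δu₁ + R₁₃u₃)`, `u₂' = 2(R₃₁u₁² − R₁₃u₃²)`, `u₃' = −u₂²(R₃₁u₁ + Δu₃)`,
then `S(t) = u₂(t)³/6 + u₁(t)·u₃(t)` is constant on `I`. -/
theorem stmt6 (Δ R13 R31 : ℂ) (I : Set ℝ) (hI : I.OrdConnected)
    (u1 u2 u3 : ℝ → ℂ)
    (h1 : ∀ t ∈ I, HasDerivWithinAt u1 (u2 t ^ 2 * (Δ * u1 t + R13 * u3 t)) I t)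
    (h2 : ∀ t ∈ I, HasDerivWithinAt u2 (2 * (R31 * u1 t ^ 2 - R13 * u3 t ^ 2)) I t)
    (h3 : ∀ t ∈ I, HasDerivWithinAt u3 (-(u2 t ^ 2 * (R31 * u1 t + Δ * u3 t))) I t) :
    ∀ s ∈ I, ∀ t ∈ I,
      u2 s ^ 3 / 6 + u1 s * u3 s = u2 t ^ 3 / 6 + u1 t * u3 t := by
  have hS : ∀ t ∈ I, HasDerivWithinAt (fun t => u2 t ^ 3 / 6 + u1 t * u3 t) 0 I t := by
    intro t ht
    refine ((((h2 t ht).fun_pow 3).div_const 6).fun_add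
      ((h1 t ht).fun_mul (h3 t ht))).congr_deriv ?_
    push_cast
    ring
  intro s hs t ht
  have h := hI.convex.norm_image_sub_le_of_norm_hasDerivWithin_le (C := 0) hS
    (fun _ _ => norm_zero.le) ht hs
  rw [zero_mul] at h
  exact sub_eq_zero.mp (norm_le_zero_iff.mp h)
end

section
/- (Integrals of the reduced R-deformed W-system.) Let I ⊆ ℝ be an interval and let u1, u2, u3 : I → ℂ be differentiable functions satisfying the reduced system u1' = u3·u2², u2' = 2·(u1² − u3²), u3' = −u1·u2². Then both S(t) := u2(t)³/6 + u1(t)·u3(t) and J(t) := u1(t)² + u3(t)² are constant on I (their derivatives vanish identically). -/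
/-- A function with vanishing derivative within an interval is constant on it. -/
theorem Set.OrdConnected.eq_of_hasDerivWithinAt_zero {E : Type*} [NormedAddCommGroup E]
    [NormedSpace ℝ E] {I : Set ℝ} (hI : I.OrdConnected) {f : ℝ → E}
    (hf : ∀ t ∈ I, HasDerivWithinAt f 0 I t) {s t : ℝ} (hs : s ∈ I) (ht : t ∈ I) :
    f s = f t := by
  have h := hI.convex.norm_image_sub_le_of_norm_hasDerivWithin_le (C := 0) hf
    (fun x _ => by simp) ht hs
  rw [zero_mul] at h
  exact sub_eq_zero.mp (norm_le_zero_iff.mp h)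

/-- (Integrals of the reduced `R`-deformed W-system.) If `u₁, u₂, u₃ : I → ℂ` are
differentiable on an interval `I ⊆ ℝ` and satisfy the reduced system
`u₁' = u₃u₂²`, `u₂' = 2(u₁² − u₃²)`, `u₃' = −u₁u₂²`, then both
`S(t) = u₂(t)³/6 + u₁(t)·u₃(t)` and `J(t) = u₁(t)² + u₃(t)²` are constant on `I`. -/
theorem stmt7 (I : Set ℝ) (hI : I.OrdConnected)
    (u1 u2 u3 : ℝ → ℂ)
    (h1 : ∀ t ∈ I, HasDerivWithinAt u1 (u3 t * u2 t ^ 2) I t)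
    (h2 : ∀ t ∈ I, HasDerivWithinAt u2 (2 * (u1 t ^ 2 - u3 t ^ 2)) I t)
    (h3 : ∀ t ∈ I, HasDerivWithinAt u3 (-(u1 t * u2 t ^ 2)) I t) :
    (∀ s ∈ I, ∀ t ∈ I,
        u2 s ^ 3 / 6 + u1 s * u3 s = u2 t ^ 3 / 6 + u1 t * u3 t) ∧
    (∀ s ∈ I, ∀ t ∈ I,
        u1 s ^ 2 + u3 s ^ 2 = u1 t ^ 2 + u3 t ^ 2) := by
  refine ⟨fun s hs t ht => hI.eq_of_hasDerivWithinAt_zero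
      (f := fun t => u2 t ^ 3 / 6 + u1 t * u3 t) (fun x hx => ?_) hs ht,
    fun s hs t ht => hI.eq_of_hasDerivWithinAt_zero
      (f := fun t => u1 t ^ 2 + u3 t ^ 2) (fun x hx => ?_) hs ht⟩
  · convert (((h2 x hx).fun_pow 3).div_const 6).fun_add ((h1 x hx).fun_mul (h3 x hx)) using 1
    push_cast
    ring
  · convert ((h1 x hx).fun_pow 2).fun_add ((h3 x hx).fun_pow 2) using 1
    push_cast
    ring
end

section
/- (The (x,y)-reduction of the R-deformed W-system.) Let I ⊆ ℝ be an interval and let u1, u2, u3 : I → ℂ be differentiable functions satisfying u1' = u3·u2², u2' = 2·(u1² − u3²), u3' = −u1·u2², with constant integral values S = u2³/6 + u1·u3 and J = u1² + u3². Define x(t) := u2(t), y(t) := 3·(u1(t)² − u3(t)²), and g(λ) := −λ⁶ + 12·S·λ³ + 9·(J² − 4·S²). Then for all t ∈ I: y(t)² = g(x(t)), x'(t) = (2/3)·y(t), and y'(t) = (1/3)·g'(x(t)), where g' denotes the derivative of the polynomial g. -/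
/-- `g(λ) = −λ⁶ + 12Sλ³ + 9(J² − 4S²)` as a polynomial over `ℂ`. -/
noncomputable def gpoly (S J : ℂ) : Polynomial ℂ :=
  -Polynomial.X ^ 6 + Polynomial.C (12 * S) * Polynomial.X ^ 3
    + Polynomial.C (9 * (J ^ 2 - 4 * S ^ 2))

/-- (The `(x,y)`-reduction of the `R`-deformed W-system.) Along solutions of the reduced
system with constant integrals `S` and `J`, setting `x := u₂`, `y := 3(u₁² − u₃²)` and
`g(λ) = −λ⁶ + 12Sλ³ + 9(J² − 4S²)`, one has `y² = g(x)`, `x' = (2/3)y`, and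
`y' = (1/3)g'(x)`. -/
theorem stmt9 (I : Set ℝ) (hI : I.OrdConnected)
    (u1 u2 u3 : ℝ → ℂ)
    (h1 : ∀ t ∈ I, HasDerivWithinAt u1 (u3 t * u2 t ^ 2) I t)
    (h2 : ∀ t ∈ I, HasDerivWithinAt u2 (2 * (u1 t ^ 2 - u3 t ^ 2)) I t)
    (h3 : ∀ t ∈ I, HasDerivWithinAt u3 (-(u1 t * u2 t ^ 2)) I t)
    (S J : ℂ)
    (hS : ∀ t ∈ I, u2 t ^ 3 / 6 + u1 t * u3 t = S)
    (hJ : ∀ t ∈ I, u1 t ^ 2 + u3 t ^ 2 = J) :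
    ∀ t ∈ I,
      (3 * (u1 t ^ 2 - u3 t ^ 2)) ^ 2 = (gpoly S J).eval (u2 t) ∧
      HasDerivWithinAt u2 (2 / 3 * (3 * (u1 t ^ 2 - u3 t ^ 2))) I t ∧
      HasDerivWithinAt (fun s => 3 * (u1 s ^ 2 - u3 s ^ 2))
        (1 / 3 * ((Polynomial.derivative (gpoly S J)).eval (u2 t))) I t := by
  intro t ht
  have hSt := hS t ht
  have hJt := hJ t ht
  refine ⟨?_, ?_, ?_⟩
  · simp only [gpoly, Polynomial.eval_add, Polynomial.eval_neg, Polynomial.eval_mul,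
      Polynomial.eval_pow, Polynomial.eval_X, Polynomial.eval_C]
    rw [← hSt, ← hJt]
    ring
  · convert h2 t ht using 1
    ring
  · refine ((((h1 t ht).fun_pow 2).fun_sub ((h3 t ht).fun_pow 2)).const_mul (3 : ℂ)).congr_deriv ?_
    simp only [gpoly, Polynomial.derivative_add, Polynomial.derivative_neg,
      Polynomial.derivative_C_mul, Polynomial.derivative_X_pow, Polynomial.derivative_C,
      Polynomial.eval_add, Polynomial.eval_neg, Polynomial.eval_mul,
      Polynomial.eval_pow, Polynomial.eval_X, Polynomial.eval_C, Polynomial.eval_zero]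
    rw [← hSt]
    push_cast
    ring
end

section
/- (Lax pair for the R-deformed W-system.) Let S, J ∈ ℂ and set g(λ) := −λ⁶ + 12·S·λ³ + 9·(J² − 4·S²). Let b ∈ ℂ satisfy b² = g(1). Let I ⊆ ℝ be an interval and let x, y : I → ℂ be differentiable functions with y(t)² = g(x(t)), x'(t) = (2/3)·y(t), y'(t) = (1/3)·g'(x(t)), and x(t) ≠ 1, y(t) ≠ 0 for all t ∈ I. For t ∈ I define u(λ,t) := (λ − x(t))·(λ − 1), m(t) := (y(t) − b)/(x(t) − 1), v(λ,t) := b + m(t)·(λ − 1), let w(·,t) ∈ ℂ[λ] be the unique polynomial with u(·,t)·w(·,t) = g − v(·,t)², and set Φ(t) := ((x(t) − 1)·g'(x(t)) − 2·y(t)·(y(t) − b)) / (3·(x(t) − 1)²). Let L(λ,t) := [[v(λ,t), w(λ,t)], [u(λ,t), −v(λ,t)]] and M(λ,t) := −(1/(λ − x(t)))·[[y(t)/3, Φ(t)], [0, −y(t)/3]]. Then for every t ∈ I and every λ ∈ ℂ with λ ≠ x(t), the entrywise t-derivative of L satisfies the Lax equation d/dt L(λ,t) = L(λ,t)·M(λ,t)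 − M(λ,t)·L(λ,t). -/
/-- `v(λ,t) = b + m(t)(λ − 1)` with `m(t) = (y(t) − b)/(x(t) − 1)`. -/
noncomputable def vfun (b : ℂ) (x y : ℝ → ℂ) (lam : ℂ) (t : ℝ) : ℂ :=
  b + (y t - b) / (x t - 1) * (lam - 1)

/-- `u(λ,t) = (λ − x(t))(λ − 1)`. -/
noncomputable def ufun (x : ℝ → ℂ) (lam : ℂ) (t : ℝ) : ℂ :=
  (lam - x t) * (lam - 1)

/-- `Φ(t) = ((x(t) − 1)g'(x(t)) − 2y(t)(y(t) − b)) / (3(x(t) − 1)²)`. -/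
noncomputable def Phi (S J b : ℂ) (x y : ℝ → ℂ) (t : ℝ) : ℂ :=
  ((x t - 1) * (Polynomial.derivative (gpoly S J)).eval (x t)
      - 2 * y t * (y t - b)) / (3 * (x t - 1) ^ 2)

/-- The Lax matrix `L(λ,t) = [[v(λ,t), w(λ,t)], [u(λ,t), −v(λ,t)]]`. -/
noncomputable def laxL (b : ℂ) (x y : ℝ → ℂ) (w : ℝ → Polynomial ℂ) (lam : ℂ) (t : ℝ) :
    Matrix (Fin 2) (Fin 2) ℂ :=
  !![vfun b x y lam t, (w t).eval lam;
     ufun x lam t, -vfun b x y lam t]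

/-- `M(λ,t) = −(1/(λ − x(t)))·[[y(t)/3, Φ(t)], [0, −y(t)/3]]`. -/
noncomputable def laxM (S J b : ℂ) (x y : ℝ → ℂ) (lam : ℂ) (t : ℝ) :
    Matrix (Fin 2) (Fin 2) ℂ :=
  (-(1 / (lam - x t))) • !![y t / 3, Phi S J b x y t; 0, -(y t / 3)]

open Polynomial in
/-- Dividing `u w = g − v²` by `λ − 1`, where `v(1)² = g(1)`. -/
theorem mul_eval_eq_of_mul_eq (S J b x m lam : ℂ) (hb : b ^ 2 = (gpoly S J).eval 1)
    (w : ℂ[X])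
    (hw : (X - C x) * (X - 1) * w = gpoly S J - (C b + C m * (X - 1)) ^ 2) :
    (lam - x) * w.eval lam
      = -(lam ^ 5 + lam ^ 4 + lam ^ 3 + lam ^ 2 + lam + 1) + 12 * S * (lam ^ 2 + lam + 1)
        - 2 * b * m - m ^ 2 * (lam - 1) := by
  have hX : (X - 1 : ℂ[X]) ≠ 0 := by simpa using X_sub_C_ne_zero (1 : ℂ)
  have hbC : (C b : ℂ[X]) ^ 2 = -1 + C (12 * S) + C (9 * (J ^ 2 - 4 * S ^ 2)) := by
    rw [← C_pow, hb]
    simp [gpoly]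
  have key : (X - C x) * w
      = -(X ^ 5 + X ^ 4 + X ^ 3 + X ^ 2 + X + 1) + C (12 * S) * (X ^ 2 + X + 1)
        - 2 * C b * C m - C m ^ 2 * (X - 1) := by
    apply mul_left_cancel₀ hX
    rw [gpoly] at hw
    linear_combination hw - hbC
  simpa using congrArg (Polynomial.eval lam) key

/-- (Lax pair for the `R`-deformed W-system.) Under the stated hypotheses on
`x, y : I → ℂ` (lying on `y² = g(x)`, flowing by `x' = (2/3)y`, `y' = (1/3)g'(x)`,
with `x ≠ 1`, `y ≠ 0`), for every `t ∈ I` and every `λ ≠ x(t)` the entrywise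
`t`-derivative of `L` satisfies the Lax equation `dL/dt = L·M − M·L`. -/
theorem stmt12 (S J b : ℂ) (hb : b ^ 2 = (gpoly S J).eval 1)
    (I : Set ℝ) (hI : I.OrdConnected) (x y : ℝ → ℂ)
    (hcurve : ∀ t ∈ I, y t ^ 2 = (gpoly S J).eval (x t))
    (hx' : ∀ t ∈ I, HasDerivWithinAt x (2 / 3 * y t) I t)
    (hy' : ∀ t ∈ I,
      HasDerivWithinAt y (1 / 3 * (Polynomial.derivative (gpoly S J)).eval (x t)) I t)
    (hx1 : ∀ t ∈ I, x t ≠ 1) (hy0 : ∀ t ∈ I, y t ≠ 0)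
    (w : ℝ → Polynomial ℂ)
    (hw : ∀ t ∈ I,
      (Polynomial.X - Polynomial.C (x t)) * (Polynomial.X - 1) * w t
        = gpoly S J - (Polynomial.C b
            + Polynomial.C ((y t - b) / (x t - 1)) * (Polynomial.X - 1)) ^ 2) :
    ∀ t ∈ I, ∀ lam : ℂ, lam ≠ x t → ∀ i j : Fin 2,
      HasDerivWithinAt (fun s => laxL b x y w lam s i j)
        ((laxL b x y w lam t * laxM S J b x y lam t
            - laxM S J b x y lam t * laxL b x y w lam t) i j) I t := by
  intro t ht lam hlam
  have hx1t : x t - 1 ≠ 0 := sub_ne_zero.mpr (hx1 t ht)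
  have hd : lam - x t ≠ 0 := sub_ne_zero.mpr hlam
  have hm : HasDerivWithinAt (fun s => (y s - b) / (x s - 1)) (Phi S J b x y t) I t := by
    refine (((hy' t ht).sub_const b).div ((hx' t ht).sub_const 1) hx1t).congr_deriv ?_
    rw [Phi]
    field_simp
  have hv : HasDerivWithinAt (fun s => vfun b x y lam s) (Phi S J b x y t * (lam - 1)) I t :=
    (hm.mul_const (lam - 1)).const_add b
  have hu : HasDerivWithinAt (fun s => ufun x lam s) (-(2 / 3 * y t) * (lam - 1)) I t :=
    ((hx' t ht).const_sub lam).mul_const (lam - 1)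
  have hW : ∀ s ∈ I, (lam - x s) * (w s).eval lam
      = -(lam ^ 5 + lam ^ 4 + lam ^ 3 + lam ^ 2 + lam + 1) + 12 * S * (lam ^ 2 + lam + 1)
        - 2 * b * ((y s - b) / (x s - 1)) - ((y s - b) / (x s - 1)) ^ 2 * (lam - 1) :=
    fun s hs => mul_eval_eq_of_mul_eq S J b (x s) _ lam hb (w s) (hw s hs)
  have hw' : HasDerivWithinAt (fun s => (w s).eval lam)
      (2 * (y t / 3 * (w t).eval lam - vfun b x y lam t * Phi S J b x y t) / (lam - x t)) I t := by
    have hnum := ((hm.const_mul (2 * b)).const_sub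
      (-(lam ^ 5 + lam ^ 4 + lam ^ 3 + lam ^ 2 + lam + 1) + 12 * S * (lam ^ 2 + lam + 1))).sub
      ((hm.pow 2).mul_const (lam - 1))
    have hquot := hnum.div ((hx' t ht).const_sub lam) hd
    have hne : ∀ᶠ s in nhdsWithin t I, lam - x s ≠ 0 :=
      ((hx' t ht).continuousWithinAt.const_sub lam).eventually_ne hd
    refine (hquot.congr_of_eventuallyEq ?_ ?_).congr_deriv ?_
    · filter_upwards [hne, self_mem_nhdsWithin] with s hs hsI
      exact (eq_div_iff hs).mpr ((mul_comm _ _).trans (hW s hsI))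
    · exact (eq_div_iff hd).mpr ((mul_comm _ _).trans (hW t ht))
    · have h := hW t ht
      simp only [Pi.sub_apply, Pi.pow_apply, vfun]
      generalize (y t - b) / (x t - 1) = m at h ⊢
      rw [← h]
      field_simp
      ring
  intro i j
  fin_cases i <;> fin_cases j
  · refine hv.congr_deriv ?_
    simp [laxL, laxM, ufun]
    field_simp
    ring
  · refine hw'.congr_deriv ?_
    simp [laxL, laxM]
    field_simp
    ring
  · refine hu.congr_deriv ?_
    simp [laxL, laxM, ufun]
    field_simp
    ring
  · refine hv.neg.congr_deriv ?_
    simp [laxL, laxM, ufun]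
    field_simp
    ring
end
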